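/- Let a, a_1, ..., a_n, a_{n+1} be letters in A_k with a_i ≠ a for 1 ≤ i ≤ n+1, and let x be an infinite word over A_k containing an occurrence of the letter a. Then for every positive integer r, the infinite word τ_a ∘ τ_{a_1} ∘ ⋯ ∘ τ_{a_n} ∘ τ_a^r ∘ τ_{a_{n+1}}(x) contains the word (τ_a ∘ τ_{a_1} ∘ ⋯ ∘ τ_{a_n}(a))^{r+2} as a factor. -/

import Mathlib

/-- The Arnoux-Rauzy morphism τ_a on letters: τ_a(a) = a, τ_a(b) = ab for b ≠ a. -/
def tau {A : Type*} [DecidableEq A] (a b : A) : List A :=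
  if b = a then [a] else [a, b]

/-- The composition τ_{a₁} ∘ τ_{a₂} ∘ ⋯ ∘ τ_{aₙ} (for the list [a₁,...,aₙ]),
applied to a letter. -/
def tauComp {A : Type*} [DecidableEq A] : List A → A → List A
  | [], c => [c]
  | b :: l, c => (tauComp l c).flatMap (tau b)

/-- `u` is a factor of the image of the infinite word `x` under the morphism
given letterwise by `f`: it is an infix of the image of some finite prefix of `x`. -/
def FactorOfImage {A : Type*} (f : A → List A) (x : ℕ → A) (u : List A) : Prop :=
  ∃ m, u <:+: ((List.range m).map x).flatMap f

theorem tauComp_append {A : Type*} [DecidableEq A] (l₁ l₂ : List A) (c : A) :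
    tauComp (l₁ ++ l₂) c = (tauComp l₂ c).flatMap (tauComp l₁) := by
  induction l₁ with
  | nil =>
    have h : (tauComp ([] : List A)) = fun c => [c] := by funext c; rfl
    rw [h]; simp
  | cons b l ih =>
    have h : tauComp (b :: l) = fun c => (tauComp l c).flatMap (tau b) := by funext c; rfl
    rw [h, List.cons_append, tauComp, ih, List.flatMap_assoc]

theorem tauComp_cons_flatMap {A : Type*} [DecidableEq A] (b : A) (l w : List A) :
    w.flatMap (tauComp (b :: l)) = (w.flatMap (tauComp l)).flatMap (tau b) := by
  rw [List.flatMap_assoc]; rfl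

theorem tau_head {A : Type*} [DecidableEq A] (b : A) (s : List A) :
    [b] <+: s.flatMap (tau b) ++ [b] := by
  cases s with
  | nil => simp
  | cons d s =>
    simp only [List.flatMap_cons, tau]
    split <;> simp [List.cons_prefix_cons]

theorem prefix_step {A : Type*} [DecidableEq A] (b : A) (l p : List A)
    (hp : ∀ w : List A, p <+: w.flatMap (tauComp l) ++ p) (w : List A) :
    p.flatMap (tau b) ++ [b] <+:
      w.flatMap (tauComp (b :: l)) ++ (p.flatMap (tau b) ++ [b]) := by
  obtain ⟨s, hs⟩ := hp w
  rw [tauComp_cons_flatMap, ← List.append_assoc, ← List.flatMap_append, ← hs,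
    List.flatMap_append, List.append_assoc, List.prefix_append_right_inj]
  exact tau_head b s

theorem exists_pal {A : Type*} [DecidableEq A] (a : A) (l : List A) (hl : ∀ b ∈ l, b ≠ a) :
    ∃ p, tauComp l a = p ++ [a] ∧ ∀ w : List A, p <+: w.flatMap (tauComp l) ++ p := by
  induction l with
  | nil => exact ⟨[], by simp [tauComp], by simp⟩
  | cons b l ih =>
    obtain ⟨p, h1, h2⟩ := ih (fun d hd => hl d (by simp [hd]))
    have hb : a ≠ b := (hl b (by simp)).symm
    refine ⟨p.flatMap (tau b) ++ [b], ?_, prefix_step b l p h2⟩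
    rw [tauComp, h1]
    simp [tau, hb]

theorem phi_prefix {A : Type*} [DecidableEq A] (a : A) (l : List A) (hl : ∀ b ∈ l, b ≠ a)
    (w : List A) :
    tauComp (a :: l) a <+: w.flatMap (tauComp (a :: l)) ++ tauComp (a :: l) a := by
  obtain ⟨p, h1, h2⟩ := exists_pal a l hl
  have h : tauComp (a :: l) a = p.flatMap (tau a) ++ [a] := by
    rw [tauComp, h1]; simp [tau]
  rw [h]
  exact prefix_step a l p h2 w

theorem rep_self {A : Type*} [DecidableEq A] (a : A) (r : ℕ) :
    tauComp (List.replicate r a) a = [a] := by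
  induction r with
  | zero => rfl
  | succ r ih => rw [List.replicate_succ, tauComp, ih]; simp [tau]

theorem rep_ne {A : Type*} [DecidableEq A] (a c : A) (hc : c ≠ a) (r : ℕ) :
    tauComp (List.replicate r a) c = List.replicate r a ++ [c] := by
  induction r with
  | zero => rfl
  | succ r ih =>
    rw [List.replicate_succ, tauComp, ih]
    have : ∀ n, (List.replicate n a).flatMap (tau a) = List.replicate n a := by
      intro n
      induction n with
      | zero => rfl
      | succ n ih => rw [List.replicate_succ, List.flatMap_cons, ih]; simp [tau]
    rw [List.flatMap_append, this]
    simp only [List.flatMap_cons, List.flatMap_nil, tau, hc, if_false, List.append_nil]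
    rw [← List.replicate_succ, List.replicate_succ']
    simp

theorem rep_head {A : Type*} [DecidableEq A] (a d : A) (r : ℕ) (hr : 1 ≤ r) :
    ∃ t, tauComp (List.replicate r a) d = a :: t := by
  by_cases h : d = a
  · subst h; exact ⟨[], rep_self d r⟩
  · obtain ⟨r, rfl⟩ := Nat.exists_eq_add_of_le' hr
    exact ⟨_, by rw [rep_ne a d h, List.replicate_succ, List.cons_append]⟩

theorem tau_cons {A : Type*} [DecidableEq A] (c d : A) : ∃ t, tau c d = c :: t := by
  unfold tau; split <;> exact ⟨_, rfl⟩

/-- If a_i ≠ a for 1 ≤ i ≤ n+1 and the letter a occurs in x, then for every r ≥ 1,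
τ_a ∘ τ_{a₁} ∘ ⋯ ∘ τ_{aₙ} ∘ τ_a^r ∘ τ_{a_{n+1}}(x) contains
(τ_a ∘ τ_{a₁} ∘ ⋯ ∘ τ_{aₙ}(a))^{r+2} as a factor. -/
theorem power_from_run {k : ℕ} (hk : 2 ≤ k) (a c : Fin k) (l : List (Fin k))
    (hl : ∀ b ∈ l, b ≠ a) (hc : c ≠ a) (x : ℕ → Fin k) (hx : ∃ n, x n = a)
    (r : ℕ) (hr : 1 ≤ r) :
    FactorOfImage (tauComp (a :: l ++ List.replicate r a ++ [c])) x
      (List.flatten (List.replicate (r + 2) (tauComp (a :: l) a))) := by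
  obtain ⟨n, hn⟩ := hx
  refine ⟨n + 3, ?_⟩
  have hF : tauComp (a :: l ++ List.replicate r a ++ [c]) =
      fun d => ((tau c d).flatMap (tauComp (List.replicate r a))).flatMap (tauComp (a :: l)) := by
    funext d
    rw [tauComp_append, tauComp, tauComp, List.flatMap_singleton, List.flatMap_assoc]
    congr 1
    funext e
    rw [tauComp_append]
  have hW : (List.range (n + 3)).map x = (List.range n).map x ++ [a, x (n+1), x (n+2)] := by
    simp [List.range_succ, hn]
  obtain ⟨t1, h1⟩ := tau_cons c (x (n+1))
  obtain ⟨t2, h2⟩ := tau_cons c (x (n+2))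
  have hca : tau c a = [c, a] := by simp [tau, hc.symm]
  have hinner : ∃ t, (tau c a ++ (tau c (x (n+1)) ++ tau c (x (n+2)))).flatMap
      (tauComp (List.replicate r a)) =
      List.replicate r a ++ [c] ++ (List.replicate (r+1) a ++ [c, a] ++ t) := by
    obtain ⟨d, t, hd⟩ : ∃ d t, t1 ++ c :: t2 = d :: t := by
      cases t1 with
      | nil => exact ⟨_, _, rfl⟩
      | cons d t => exact ⟨_, _, rfl⟩
    obtain ⟨u, hu⟩ := rep_head a d r hr
    refine ⟨u ++ t.flatMap (tauComp (List.replicate r a)), ?_⟩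
    rw [hca, h1, h2, List.cons_append (a := c) (as := t1), hd]
    simp [rep_self, rep_ne a c hc, hu, List.replicate_succ]
  obtain ⟨t, ht⟩ := hinner
  obtain ⟨q, hq⟩ := phi_prefix a l hl [c]
  have hrep : ∀ m, (List.replicate m a).flatMap (tauComp (a :: l)) =
      (List.replicate m (tauComp (a :: l) a)).flatten := by
    intro m; simp [List.flatMap]
  have hbig : ([a, x (n+1), x (n+2)]).flatMap
      (tauComp (a :: l ++ List.replicate r a ++ [c])) =
      (List.replicate r a ++ [c]).flatMap (tauComp (a :: l)) ++
      ((List.replicate (r+2) (tauComp (a :: l) a)).flatten ++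
        (q ++ t.flatMap (tauComp (a :: l)))) := by
    have e : ([a, x (n+1), x (n+2)]).flatMap
        (tauComp (a :: l ++ List.replicate r a ++ [c])) =
        ((tau c a ++ (tau c (x (n+1)) ++ tau c (x (n+2)))).flatMap
          (tauComp (List.replicate r a))).flatMap (tauComp (a :: l)) := by
      rw [hF]; simp only [List.flatMap_cons, List.flatMap_nil, List.flatMap_append, List.append_nil]
    have hq' : [c, a].flatMap (tauComp (a :: l)) = tauComp (a :: l) a ++ q := by
      rw [hq]; simp only [List.flatMap_cons, List.flatMap_nil, List.append_nil]
    rw [e, ht, List.flatMap_append, List.flatMap_append (xs := _ ++ [c, a]),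
      List.flatMap_append (ys := [c, a]), hrep, hq', List.replicate_succ' (n := r + 1),
      List.flatten_append]
    simp only [List.flatten_cons, List.flatten_nil, List.append_nil, List.append_assoc]
  rw [hW, List.flatMap_append, hbig]
  exact ⟨_, _, by rw [List.append_assoc, List.append_assoc]⟩
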